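/- arXiv:2505.21120 — 4 statements merged into one kernel-verified Lean document; each statement's English description precedes it below -/
import Mathlib

section
/- Let γ ∈ [-3,0) and define the cut-off kernel ã(z) = ⟨z⟩^γ |z|² Π(z). Then ã is smooth on all of ℝ³, satisfies a(z) ≥ ã(z) in the sense of symmetric matrices, and the following ellipticity estimate holds: for every E, H̄ > 0 there exists c₀ > 0 depending only on γ, E and H̄ such that for every probability density f on ℝ³ with ∫ |v|² f ≤ E and ∫ f ln f ≤ H̄, the matrix (ã ⋆ f)(v) := ∫ ã(v−v') f(v') dv' satisfies (ã ⋆ f)(v) ≥ c₀ ⟨v⟩^γ Id for all v ∈ ℝ³, where Id is the 3×3 identity matrix. -/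
noncomputable section

open MeasureTheory Real
open scoped ENNReal RealInnerProductSpace

/-- The velocity space ℝ³. -/
abbrev V3 : Type := EuclideanSpace ℝ (Fin 3)

/-- 3×3 real matrices. -/
abbrev Mat3 : Type := Matrix (Fin 3) (Fin 3) ℝ

/-- Japanese bracket ⟨v⟩ = √(1+|v|²). -/
def jap (v : V3) : ℝ := Real.sqrt (1 + ‖v‖ ^ 2)

/-- `i`-th basis vector of ℝ³. -/
def esingle (i : Fin 3) : V3 := EuclideanSpace.single i (1 : ℝ)

/-- Orthogonal projection Π(z) onto z^⊥. -/
def proj (z : V3) : Mat3 := fun i j =>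
  (if i = j then (1 : ℝ) else 0) - (z i / ‖z‖) * (z j / ‖z‖)

/-- Landau kernel a(z) = |z|^{γ+2} Π(z). -/
def landauKernel (γ : ℝ) (z : V3) : Mat3 := fun i j => ‖z‖ ^ (γ + 2) * proj z i j

/-- Cut-off kernel ã(z) = ⟨z⟩^γ |z|² Π(z). -/
def cutoffKernel (γ : ℝ) (z : V3) : Mat3 := fun i j => jap z ^ γ * ‖z‖ ^ 2 * proj z i j

/-- Bilinear form ⟨A w, z⟩. -/
def bilin (A : Mat3) (w z : V3) : ℝ := ∑ i, ∑ j, A i j * w i * z j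

/-- Quadratic form A : w^{⊗2}. -/
def quadForm (A : Mat3) (w : V3) : ℝ := bilin A w w

/-- Matrix dot product A : B. -/
def matDot (A B : Mat3) : ℝ := ∑ i, ∑ j, A i j * B i j

/-- (Frobenius) norm of a 3×3 matrix. -/
def matNorm (A : Mat3) : ℝ := Real.sqrt (∑ i, ∑ j, (A i j) ^ 2)

/-- Entropy H(f) = ∫ f ln f. -/
def entropy (f : V3 → ℝ) : ℝ := ∫ v, f v * Real.log (f v)

/-- Relative entropy H(f|g) = ∫ ((f/g) ln(f/g) − f/g + 1) g ∈ [0,∞]. -/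
def relEntropy (f g : V3 → ℝ) : ℝ≥0∞ :=
  ∫⁻ v, ENNReal.ofReal ((f v / g v * Real.log (f v / g v) - f v / g v + 1) * g v)

/-- Hessian matrix of a function on ℝ³. -/
def hess (φ : V3 → ℝ) (v : V3) : Mat3 := fun i j =>
  iteratedFDeriv ℝ 2 φ v ![esingle i, esingle j]

/-- Hessian matrix within a set. -/
def hessW (φ : V3 → ℝ) (s : Set V3) (v : V3) : Mat3 := fun i j =>
  iteratedFDerivWithin ℝ 2 φ s v ![esingle i, esingle j]

/-- Gradient of the logarithm, ∇ ln φ. -/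
def logGrad (φ : V3 → ℝ) (v : V3) : V3 := gradient (fun w => Real.log (φ w)) v

/-- Hessian of the logarithm, ∇² ln φ. -/
def logHess (φ : V3 → ℝ) (v : V3) : Mat3 := hess (fun w => Real.log (φ w)) v

/-- `G` is the weak gradient of `F` on ℝ⁶ ≃ ℝ³ × ℝ³. -/
def IsWeakGrad6 (F : V3 × V3 → ℝ) (G : V3 × V3 → V3 × V3) : Prop :=
  ∀ φ : V3 × V3 → ℝ, ContDiff ℝ (⊤ : ℕ∞) φ → HasCompactSupport φ →
    ∀ e : V3 × V3,
      (∫ p : V3 × V3, F p * fderiv ℝ φ p e) =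
        - ∫ p : V3 × V3, (⟪(G p).1, e.1⟫ + ⟪(G p).2, e.2⟫) * φ p

/-- `G` is the weak gradient of `F` on ℝ³. -/
def IsWeakGrad3 (F : V3 → ℝ) (G : V3 → V3) : Prop :=
  ∀ φ : V3 → ℝ, ContDiff ℝ (⊤ : ℕ∞) φ → HasCompactSupport φ →
    ∀ e : V3, (∫ v, F v * fderiv ℝ φ v e) = - ∫ v, ⟪G v, e⟫ * φ v

/-- Entropy production functional associated with a weak gradient of √(f f'). -/
def dissipation (γ : ℝ) (G : V3 × V3 → V3 × V3) : ℝ≥0∞ :=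
  ∫⁻ p : V3 × V3,
    ENNReal.ofReal (quadForm (landauKernel γ (p.1 - p.2)) ((G p).1 - (G p).2))

/-- Villani's H-solutions of the Landau equation on [0,T], with weak gradient data
`fGrad s` for √(f_s f_s'). -/
structure IsHSolution (γ T : ℝ) (f : ℝ → V3 → ℝ) (fGrad : ℝ → V3 × V3 → V3 × V3) : Prop where
  nonneg : ∀ t ∈ Set.Icc 0 T, ∀ v, 0 ≤ f t v
  integrable : ∀ t ∈ Set.Icc 0 T, Integrable (f t)
  entIntegrable : ∀ t ∈ Set.Icc 0 T, Integrable (fun v => f t v * Real.log (f t v))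
  contDistrib : ∀ φ : V3 → ℝ, ContDiff ℝ (⊤ : ℕ∞) φ → HasCompactSupport φ →
    ContinuousOn (fun t => ∫ v, φ v * f t v) (Set.Icc 0 T)
  mass : ∀ t ∈ Set.Icc 0 T, (∫ v, f t v) = 1
  momentumIntegrable : ∀ t ∈ Set.Icc 0 T, Integrable (fun v => f t v • v)
  momentum : ∀ t ∈ Set.Icc 0 T, (∫ v, f t v • v) = ∫ v, f 0 v • v
  energyIntegrable : ∀ t ∈ Set.Icc 0 T, Integrable (fun v => ‖v‖ ^ 2 * f t v)
  energy : ∀ t ∈ Set.Icc 0 T, (∫ v, ‖v‖ ^ 2 * f t v) = ∫ v, ‖v‖ ^ 2 * f 0 v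
  weakGrad : ∀ᵐ s ∂(volume.restrict (Set.Icc 0 T)),
    IsWeakGrad6 (fun p => Real.sqrt (f s p.1 * f s p.2)) (fGrad s)
  dissipationFinite : ∀ t ∈ Set.Icc 0 T,
    (∫⁻ s in Set.Ioc (0 : ℝ) t, dissipation γ (fGrad s)) < ⊤
  entropyProd : ∀ t ∈ Set.Icc 0 T,
    entropy (f t) + 2 * (∫⁻ s in Set.Ioc (0 : ℝ) t, dissipation γ (fGrad s)).toReal ≤
      entropy (f 0)
  weakForm : ∀ φ : ℝ → V3 → ℝ,
    ContDiff ℝ 2 (fun q : ℝ × V3 => φ q.1 q.2) →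
    HasCompactSupport (fun q : ℝ × V3 => φ q.1 q.2) →
    ∀ t ∈ Set.Icc 0 T,
      (∫ v, φ t v * f t v) - (∫ v, φ 0 v * f 0 v) =
        (∫ s in (0 : ℝ)..t, ∫ v, deriv (fun r => φ r v) s * f s v) -
          ∫ s in (0 : ℝ)..t, ∫ p : V3 × V3,
            bilin (landauKernel γ (p.1 - p.2))
              (gradient (φ s) p.1 - gradient (φ s) p.2)
              ((fGrad s p).1 - (fGrad s p).2) * Real.sqrt (f s p.1 * f s p.2)

/-- Convolved Landau matrix ā = a ⋆ f. -/
def abar (γ : ℝ) (f : V3 → ℝ) (v : V3) : Mat3 := fun i j =>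
  ∫ w, landauKernel γ (v - w) i j * f w

/-- Zero order coefficient c̄ of the Landau equation in nondivergence form. -/
def cbar (γ : ℝ) (f : V3 → ℝ) (v : V3) : ℝ :=
  if γ = -3 then 8 * Real.pi * f v else 2 * (γ + 3) * ∫ w, ‖v - w‖ ^ γ * f w

/-- Convolution of the cut-off kernel with a density. -/
def cutoffConv (γ : ℝ) (f : V3 → ℝ) (v : V3) : Mat3 := fun i j =>
  ∫ w, cutoffKernel γ (v - w) i j * f w

/-- Classical solution of the Landau equation on a time set `I`
(in nondivergence parabolic form ∂_t g = ā : ∇²g + c̄ g). -/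
structure IsClassicalSolution (γ : ℝ) (I : Set ℝ) (g : ℝ → V3 → ℝ) : Prop where
  pos : ∀ t ∈ I, ∀ v, 0 < g t v
  timeC1 : ∀ v, ContDiffOn ℝ 1 (fun t => g t v) I
  velC2 : ∀ t ∈ I, ContDiff ℝ 2 (g t)
  eqn : ∀ t ∈ I, ∀ v,
    derivWithin (fun s => g s v) I t =
      matDot (abar γ (g t) v) (hess (g t) v) + cbar γ (g t) v * g t v

/-- The moment exponent ρ = max(2κ, 2κ+2γ+4, 2ζ, ν). -/
def rhoExp (γ κ ζ ν : ℝ) : ℝ := max (max (2 * κ) (2 * κ + 2 * γ + 4)) (max (2 * ζ) ν)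

/-- Setting (⋆) of the paper. -/
structure Setting (γ T : ℝ) where
  f : ℝ → V3 → ℝ
  fGrad : ℝ → V3 × V3 → V3 × V3
  g : ℝ → V3 → ℝ
  κ : ℝ
  ν : ℝ
  ζ : ℝ
  K1 : ℝ → ℝ
  K2 : ℝ → ℝ
  K3 : ℝ → ℝ
  Mf : ℝ
  Mg : ℝ
  hγ : γ ∈ Set.Ico (-3 : ℝ) 0
  hT : 0 < T
  hf : IsHSolution γ T f fGrad
  hg : IsClassicalSolution γ (Set.Icc 0 T) g
  hκ : 1 ≤ κ
  hν : 1 ≤ ν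
  hζ : 0 ≤ ζ
  K1nonneg : ∀ t, 0 ≤ K1 t
  K2nonneg : ∀ t, 0 ≤ K2 t
  K3nonneg : ∀ t, 0 ≤ K3 t
  K1meas : Measurable K1
  K2meas : Measurable K2
  K3meas : Measurable K3
  K1bound : ∀ t ∈ Set.Icc 0 T, ∀ v, ‖logGrad (g t) v‖ ≤ K1 t * jap v ^ κ
  K2bound : ∀ t ∈ Set.Icc 0 T, ∀ v,
    |derivWithin (fun s => Real.log (g s v)) (Set.Icc 0 T) t| ≤ K2 t * jap v ^ ν
  K3bound : ∀ t ∈ Set.Icc 0 T, ∀ v, matNorm (logHess (g t) v) ≤ K3 t * jap v ^ ζ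
  Kint : IntegrableOn (fun t => K2 t + K1 t ^ 2 + K3 t ^ 2) (Set.Icc 0 T)
  fMomentInt : ∀ t ∈ Set.Icc 0 T,
    Integrable (fun v => jap v ^ (rhoExp γ κ ζ ν - γ) * f t v)
  fMoment : ∀ t ∈ Set.Icc 0 T, (∫ v, jap v ^ (rhoExp γ κ ζ ν - γ) * f t v) ≤ Mf
  gMomentInt : ∀ t ∈ Set.Icc 0 T,
    Integrable (fun v => jap v ^ (rhoExp γ κ ζ ν - γ) * g t v)
  gMoment : ∀ t ∈ Set.Icc 0 T, (∫ v, jap v ^ (rhoExp γ κ ζ ν - γ) * g t v) ≤ Mg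

/-- The good term 𝒢_s. -/
def goodTerm (γ : ℝ) (f g : ℝ → V3 → ℝ) (fGrad : ℝ → V3 × V3 → V3 × V3) (s : ℝ) : ℝ :=
  2 * ∫ p : V3 × V3,
    quadForm (landauKernel γ (p.1 - p.2))
      (((fGrad s p).1 - (fGrad s p).2) -
        Real.sqrt (f s p.1 * f s p.2) • (logGrad (g s) p.1 - logGrad (g s) p.2))

/-- The vector field a(v−v')(∇−∇')(g g'). -/
def landauFlux (γ : ℝ) (g : V3 → ℝ) (v w : V3) : Fin 3 → ℝ := fun i =>
  ∑ j, landauKernel γ (v - w) i j * (g w * (gradient g v) j - g v * (gradient g w) j)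

/-- (∇−∇')·[a(v−v')(∇−∇')(g g')]. -/
def divDiffFlux (γ : ℝ) (g : V3 → ℝ) (v w : V3) : ℝ :=
  ∑ i, (fderiv ℝ (fun z => landauFlux γ g z w i) v (esingle i) -
        fderiv ℝ (fun z => landauFlux γ g v z i) w (esingle i))

/-- The bad term ℬ_s. -/
def badTerm (γ : ℝ) (f g : ℝ → V3 → ℝ) (s : ℝ) : ℝ :=
  (1 / 2) * ∫ p : V3 × V3,
    (f s p.1 - g s p.1) * (f s p.2 - g s p.2) / (g s p.1 * g s p.2) *
      divDiffFlux γ (g s) p.1 p.2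

/-- Weighted relative Fisher information ∫ |2∇√f − √f ∇ln g|² ⟨v⟩^γ dv. -/
def relFisher (γ : ℝ) (f g : V3 → ℝ) (fGrad3 : V3 → V3) : ℝ :=
  ∫ v, ‖(2 : ℝ) • fGrad3 v - Real.sqrt (f v) • logGrad g v‖ ^ 2 * jap v ^ γ

/-- ‖⟨v⟩^{−κ} ∇ ln g_s‖_{L^∞(ℝ³)} ∈ [0,∞]. -/
def gradLogSup (g : ℝ → V3 → ℝ) (κ s : ℝ) : ℝ≥0∞ :=
  ⨆ v : V3, ENNReal.ofReal (jap v ^ (-κ) * ‖logGrad (g s) v‖)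

/-- ‖⟨v⟩^{−ν} ∂_s ln g_s‖_{L^∞(ℝ³)} ∈ [0,∞]. -/
def dtLogSup (g : ℝ → V3 → ℝ) (T ν s : ℝ) : ℝ≥0∞ :=
  ⨆ v : V3, ENNReal.ofReal
    (jap v ^ (-ν) * |derivWithin (fun r => Real.log (g r v)) (Set.Icc 0 T) s|)

/-- ‖⟨v⟩^{−ζ} ∇² ln g_s‖_{L^∞(ℝ³)} ∈ [0,∞]. -/
def hessLogSup (g : ℝ → V3 → ℝ) (ζ s : ℝ) : ℝ≥0∞ :=
  ⨆ v : V3, ENNReal.ofReal (jap v ^ (-ζ) * matNorm (logHess (g s) v))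

/-- Open cube Σ_R(v₀) = v₀ + (−R,R)³. -/
def cube (v₀ : V3) (R : ℝ) : Set V3 := {v | ∀ i, |v i - v₀ i| < R}

/-- Closed cube v₀ + [−R,R]³ centered at the origin. -/
def ccube (R : ℝ) : Set V3 := {v | ∀ i, |v i| ≤ R}

/-- Distance to the boundary of the cube Σ_R(v₀). -/
def dCube (v₀ : V3) (R : ℝ) (v : V3) : ℝ :=
  Finset.univ.inf' (Finset.univ_nonempty) fun i : Fin 3 => R - |v i - v₀ i|

/-- The moment exponent k(γ,ℓ,δ) of Theorem 2. -/
def kExp (γ ℓ δ : ℝ) : ℝ := 8 * (max (2 + (ℓ - 2) / (2 + δ)) 1 + (2 - γ) / (2 * δ)) - γ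

lemma jap_pos (z : V3) : 0 < jap z := Real.sqrt_pos.2 (by positivity)

lemma norm_sq_V3 (z : V3) : ‖z‖ ^ 2 = z 0 ^ 2 + z 1 ^ 2 + z 2 ^ 2 := by
  rw [EuclideanSpace.norm_sq_eq, Fin.sum_univ_three]; simp

lemma inner_V3 (z ξ : V3) : ⟪z, ξ⟫ = z 0 * ξ 0 + z 1 * ξ 1 + z 2 * ξ 2 := by
  rw [PiLp.inner_apply, Fin.sum_univ_three]; simp; ring

lemma sq_mul_proj (z : V3) (i j : Fin 3) :
    ‖z‖ ^ 2 * proj z i j = (if i = j then ‖z‖ ^ 2 else 0) - z i * z j := by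
  unfold proj
  by_cases hz : z = 0
  · subst hz; simp
  · have : ‖z‖ ≠ 0 := norm_ne_zero_iff.2 hz
    split_ifs
    · field_simp
    · field_simp
      ring

lemma cutoff_eq (γ : ℝ) (z : V3) (i j : Fin 3) :
    cutoffKernel γ z i j = jap z ^ γ * ((if i = j then ‖z‖ ^ 2 else 0) - z i * z j) := by
  unfold cutoffKernel; rw [mul_assoc, sq_mul_proj]

lemma quad_cutoff (γ : ℝ) (z ξ : V3) :
    quadForm (cutoffKernel γ z) ξ = jap z ^ γ * (‖z‖ ^ 2 * ‖ξ‖ ^ 2 - ⟪z, ξ⟫ ^ 2) := by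
  simp only [quadForm, bilin, cutoff_eq, Fin.sum_univ_three, inner_V3]
  rw [norm_sq_V3 ξ]
  simp
  ring

lemma cs (z ξ : V3) : 0 ≤ ‖z‖ ^ 2 * ‖ξ‖ ^ 2 - ⟪z, ξ⟫ ^ 2 := by
  have h := abs_real_inner_le_norm z ξ
  have := pow_le_pow_left₀ (abs_nonneg _) h 2
  rw [sq_abs, mul_pow] at this
  linarith

lemma smooth_part (γ : ℝ) (i j : Fin 3) :
    ContDiff ℝ (⊤ : ℕ∞) (fun z : V3 => cutoffKernel γ z i j) := by
  simp only [cutoff_eq]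
  have h1 : ContDiff ℝ (⊤ : ℕ∞) (fun z : V3 => ‖z‖ ^ 2) := contDiff_norm_sq ℝ
  have h2 : ContDiff ℝ (⊤ : ℕ∞) (fun z : V3 => jap z ^ γ) := by
    apply ContDiff.rpow_const_of_ne
    · exact (contDiff_const.add h1).sqrt (fun z => by positivity)
    · exact fun z => (jap_pos z).ne'
  have h3 : ∀ k : Fin 3, ContDiff ℝ (⊤ : ℕ∞) (fun z : V3 => z k) := fun k =>
    (EuclideanSpace.proj (𝕜 := ℝ) k).contDiff
  apply h2.mul
  apply ContDiff.sub _ ((h3 i).mul (h3 j))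
  split_ifs
  · exact h1
  · exact contDiff_const

lemma norm_le_jap (z : V3) : ‖z‖ ≤ jap z := by
  apply Real.le_sqrt_of_sq_le; linarith

lemma dom_part (γ : ℝ) (hγ : γ ∈ Set.Ico (-3 : ℝ) 0) (z ξ : V3) :
    quadForm (cutoffKernel γ z) ξ ≤ quadForm (landauKernel γ z) ξ := by
  by_cases hz : z = 0
  · subst hz
    rw [quad_cutoff]
    simp [quadForm, bilin, landauKernel, proj, Fin.sum_univ_three]
    have : 0 ≤ (0:ℝ) ^ (γ + 2) := by positivity
    have h2 : 0 ≤ (0:ℝ) ^ (γ + 2) * (ξ 0 ^ 2 + ξ 1 ^ 2 + ξ 2 ^ 2) := by positivity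
    linarith
  · have hp : 0 < ‖z‖ := norm_pos_iff.2 hz
    have : quadForm (landauKernel γ z) ξ = ‖z‖ ^ γ * (‖z‖ ^ 2 * ‖ξ‖ ^ 2 - ⟪z, ξ⟫ ^ 2) := by
      have e : ∀ i j, landauKernel γ z i j
          = ‖z‖ ^ γ * ((if i = j then ‖z‖ ^ 2 else 0) - z i * z j) := by
        intro i j
        rw [← sq_mul_proj, landauKernel, Real.rpow_add hp]
        norm_num [mul_assoc]
      simp only [quadForm, bilin, e, Fin.sum_univ_three, inner_V3]
      rw [norm_sq_V3 ξ]
      simp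
      ring
    rw [this, quad_cutoff]
    apply mul_le_mul_of_nonneg_right _ (cs z ξ)
    exact Real.rpow_le_rpow_of_nonpos hp (norm_le_jap z) hγ.2.le

lemma jap_ge_one (z : V3) : 1 ≤ jap z := by
  apply Real.le_sqrt_of_sq_le; nlinarith [sq_nonneg ‖z‖]

lemma entry_bound (γ : ℝ) (hγ : γ < 0) (z : V3) (i j : Fin 3) :
    ‖cutoffKernel γ z i j‖ ≤ 2 * ‖z‖ ^ 2 := by
  rw [cutoff_eq, norm_mul]
  have h1 : ‖jap z ^ γ‖ ≤ 1 := by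
    rw [Real.norm_of_nonneg (by have := jap_pos z; positivity)]
    exact Real.rpow_le_one_of_one_le_of_nonpos (jap_ge_one z) hγ.le
  have hk : ∀ k : Fin 3, ‖z k‖ ≤ ‖z‖ := fun k => PiLp.norm_apply_le z k
  have h2 : ‖(if i = j then ‖z‖ ^ 2 else 0) - z i * z j‖ ≤ 2 * ‖z‖ ^ 2 := by
    refine (norm_sub_le _ _).trans ?_
    have : ‖z i * z j‖ ≤ ‖z‖ * ‖z‖ := by
      rw [norm_mul]; exact mul_le_mul (hk i) (hk j) (norm_nonneg _) (norm_nonneg _)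
    have h3 : ‖(if i = j then ‖z‖ ^ 2 else 0)‖ ≤ ‖z‖ ^ 2 := by
      split_ifs <;> simp
    nlinarith
  calc _ ≤ 1 * (2 * ‖z‖ ^ 2) := mul_le_mul h1 h2 (norm_nonneg _) (by norm_num)
    _ = _ := one_mul _

lemma entry_int (γ : ℝ) (hγ : γ < 0) (f : V3 → ℝ) (h0 : ∀ v, 0 ≤ f v) (hf : Integrable f)
    (hE : Integrable (fun v => ‖v‖ ^ 2 * f v)) (v : V3) (i j : Fin 3) :
    Integrable (fun w => cutoffKernel γ (v - w) i j * f w) := by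
  have hc : Continuous (fun w : V3 => cutoffKernel γ (v - w) i j) :=
    (smooth_part γ i j).continuous.comp (continuous_const.sub continuous_id)
  refine Integrable.mono' ((hf.const_mul (4 * ‖v‖ ^ 2)).add (hE.const_mul 4))
    (hc.aestronglyMeasurable.mul hf.1) (Filter.Eventually.of_forall fun w => ?_)
  rw [norm_mul, Real.norm_of_nonneg (h0 w)]
  have h1 := entry_bound γ hγ (v - w) i j
  have h2 : ‖v - w‖ ^ 2 ≤ 2 * ‖v‖ ^ 2 + 2 * ‖w‖ ^ 2 := by
    have := norm_sub_le v w
    nlinarith [norm_nonneg (v - w), sq_nonneg (‖v‖ - ‖w‖)]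
  calc _ ≤ (4 * ‖v‖ ^ 2 + 4 * ‖w‖ ^ 2) * f w :=
        mul_le_mul_of_nonneg_right (by linarith) (h0 w)
    _ = _ := by simp; ring

lemma quad_conv (γ : ℝ) (hγ : γ < 0) (f : V3 → ℝ) (h0 : ∀ v, 0 ≤ f v) (hf : Integrable f)
    (hE : Integrable (fun v => ‖v‖ ^ 2 * f v)) (v ξ : V3) :
    Integrable (fun w => quadForm (cutoffKernel γ (v - w)) ξ * f w) ∧
    quadForm (cutoffConv γ f v) ξ = ∫ w, quadForm (cutoffKernel γ (v - w)) ξ * f w := by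
  have e : (fun w => quadForm (cutoffKernel γ (v - w)) ξ * f w)
      = fun w => ∑ i, ∑ j, (cutoffKernel γ (v - w) i j * f w) * (ξ i * ξ j) := by
    ext w
    simp only [quadForm, bilin, Finset.sum_mul]
    refine Finset.sum_congr rfl fun i _ => Finset.sum_congr rfl fun j _ => by ring
  have hi : ∀ i j, Integrable (fun w => (cutoffKernel γ (v - w) i j * f w) * (ξ i * ξ j)) :=
    fun i j => (entry_int γ hγ f h0 hf hE v i j).mul_const _
  rw [e]
  refine ⟨integrable_finsetSum _ fun i _ => integrable_finsetSum _ fun j _ => hi i j, ?_⟩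
  rw [integral_finsetSum _ fun i _ => integrable_finsetSum _ fun j _ => hi i j]
  simp only [quadForm, bilin, cutoffConv]
  refine Finset.sum_congr rfl fun i _ => ?_
  rw [integral_finsetSum _ fun j _ => hi i j]
  refine Finset.sum_congr rfl fun j _ => ?_
  rw [integral_mul_const]; ring

lemma peetre (v w : V3) (R : ℝ) (hw : ‖w‖ ≤ R) :
    jap (v - w) ≤ jap v * Real.sqrt (2 * (1 + R ^ 2)) := by
  unfold jap
  rw [← Real.sqrt_mul (by positivity)]
  apply Real.sqrt_le_sqrt
  have h2 : ‖v - w‖ ^ 2 ≤ 2 * ‖v‖ ^ 2 + 2 * ‖w‖ ^ 2 := by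
    have := norm_sub_le v w
    nlinarith [norm_nonneg (v - w), sq_nonneg (‖v‖ - ‖w‖)]
  have h3 : ‖w‖ ^ 2 ≤ R ^ 2 := pow_le_pow_left₀ (norm_nonneg _) hw 2
  nlinarith [mul_nonneg (sq_nonneg ‖v‖) (sq_nonneg R)]

lemma young (x a : ℝ) (hx : 0 ≤ x) : x * a ≤ x * Real.log x - x + Real.exp a := by
  rcases hx.eq_or_lt with rfl | hx
  · simp; positivity
  · have h := Real.add_one_le_exp (a - Real.log x)
    rw [Real.exp_sub, Real.exp_log hx] at h
    have := mul_le_mul_of_nonneg_left h hx.le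
    rw [mul_div_cancel₀ _ hx.ne'] at this
    linarith

lemma gauss_int : Integrable (fun v : V3 => Real.exp (-‖v‖ ^ 2)) := by
  have := (GaussianFourier.integrable_cexp_neg_mul_sq_norm_add (V := V3) (b := 1) (by simp) 0 0).norm
  refine this.congr (Filter.Eventually.of_forall fun v => ?_)
  simp [Complex.norm_exp]
  norm_cast

lemma mass_bound (f : V3 → ℝ) (h0 : ∀ v, 0 ≤ f v) (hf : Integrable f)
    (hE : Integrable (fun v => ‖v‖ ^ 2 * f v))
    (hL : Integrable (fun v => f v * Real.log (f v))) (A : Set V3) (hA : MeasurableSet A)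
    (hfin : volume A ≠ ⊤) (l : ℝ) :
    l * ∫ v in A, f v ≤ entropy f + (∫ v, ‖v‖ ^ 2 * f v)
      + (∫ v : V3, Real.exp (-‖v‖ ^ 2)) + Real.exp l * volume.real A := by
  have hind : Integrable (A.indicator (fun _ => Real.exp l) : V3 → ℝ) :=
    (integrable_indicator_iff hA).2 (integrableOn_const hfin)
  have h1 : l * ∫ v in A, f v = ∫ v, l * A.indicator f v := by
    rw [integral_const_mul, integral_indicator hA]
  have h2 : Real.exp l * volume.real A = ∫ v, A.indicator (fun _ => Real.exp l) v := by
    rw [integral_indicator hA, setIntegral_const, smul_eq_mul, mul_comm]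
  have i1 : Integrable (fun v => f v * Real.log (f v) + ‖v‖ ^ 2 * f v) := hL.add hE
  have i2 : Integrable (fun v => f v * Real.log (f v) + ‖v‖ ^ 2 * f v + Real.exp (-‖v‖ ^ 2)) :=
    i1.add gauss_int
  rw [h1, h2, entropy, ← integral_add hL hE, ← integral_add i1 gauss_int,
    ← integral_add i2 hind]
  refine integral_mono ((hf.indicator hA).const_mul l) (i2.add hind) ?_
  intro v
  by_cases hv : v ∈ A
  · simp only [hv, Set.indicator_of_mem, Pi.add_apply]
    have h := young (f v) (l - ‖v‖ ^ 2) (h0 v)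
    have h3 : Real.exp (l - ‖v‖ ^ 2) ≤ Real.exp l := Real.exp_le_exp.2 (by nlinarith [sq_nonneg ‖v‖])
    have := Real.exp_pos (-‖v‖ ^ 2)
    nlinarith [h0 v]
  · simp only [hv, not_false_eq_true, Set.indicator_of_notMem, Pi.add_apply]
    have h := young (f v) (- ‖v‖ ^ 2) (h0 v)
    nlinarith [h0 v]

lemma geom (ξ : V3) (hξ : ξ ≠ 0) : ∃ b : OrthonormalBasis (Fin 3) ℝ V3,
    ∀ z : V3, (b.repr z 1) ^ 2 * ‖ξ‖ ^ 2 ≤ ‖z‖ ^ 2 * ‖ξ‖ ^ 2 - ⟪z, ξ⟫ ^ 2 := by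
  have hp : ‖ξ‖ ≠ 0 := norm_ne_zero_iff.2 hξ
  have hu : ‖(‖ξ‖⁻¹ • ξ)‖ = 1 := by rw [norm_smul]; simp [hp]
  obtain ⟨b, hb⟩ := Orthonormal.exists_orthonormalBasis_extension_of_card_eq (𝕜 := ℝ) (E := V3)
    (ι := Fin 3) (by simp) (v := fun _ => ‖ξ‖⁻¹ • ξ) (s := {0}) (by
      constructor
      · rintro ⟨i, hi⟩; simpa using hu
      · rintro ⟨i, hi⟩ ⟨j, hj⟩ hij
        simp at hi hj; subst hi hj; simp at hij)
  refine ⟨b, fun z => ?_⟩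
  have h0 := hb 0 (by simp)
  have h1 : ‖z‖ ^ 2 = b.repr z 0 ^ 2 + b.repr z 1 ^ 2 + b.repr z 2 ^ 2 := by
    rw [← norm_sq_V3, LinearIsometryEquiv.norm_map]
  have h2 : ⟪z, ξ⟫ = b.repr z 0 * ‖ξ‖ := by
    rw [OrthonormalBasis.repr_apply_apply, h0, real_inner_smul_left, real_inner_comm]
    field_simp
  rw [h1, h2]
  nlinarith [mul_nonneg (sq_nonneg (b.repr z 2)) (sq_nonneg ‖ξ‖)]

def slabBox (R δ c : ℝ) : Set (Fin 3 → ℝ) :=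
  Set.Icc ![-R, c - δ, -R] ![R, c + δ, R]

lemma slab_vol (b : OrthonormalBasis (Fin 3) ℝ V3) (R δ c : ℝ) (hR : 0 ≤ R) (hδ : 0 ≤ δ) :
    MeasurableSet {w : V3 | (b.repr w).ofLp ∈ slabBox R δ c} ∧
    volume {w : V3 | (b.repr w).ofLp ∈ slabBox R δ c} = ENNReal.ofReal (8 * δ * R ^ 2) := by
  have hm : MeasurePreserving (fun w : V3 => (b.repr w).ofLp) :=
    (PiLp.volume_preserving_ofLp (Fin 3)).comp b.measurePreserving_repr
  have hs : MeasurableSet (slabBox R δ c) := measurableSet_Icc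
  refine ⟨hm.measurable hs, ?_⟩
  have := hm.measure_preimage hs.nullMeasurableSet
  refine this.trans ?_
  rw [slabBox, Real.volume_Icc_pi, Fin.prod_univ_three, ← ENNReal.ofReal_mul (by simp; linarith),
    ← ENNReal.ofReal_mul (by simp; nlinarith)]
  congr 1
  simp
  ring

lemma pointwise (γ : ℝ) (hγ : γ < 0) (R δ : ℝ) (hR : 0 < R) (hδ : 0 < δ) (v ξ : V3)
    (b : OrthonormalBasis (Fin 3) ℝ V3)
    (hb : ∀ z : V3, (b.repr z 1) ^ 2 * ‖ξ‖ ^ 2 ≤ ‖z‖ ^ 2 * ‖ξ‖ ^ 2 - ⟪z, ξ⟫ ^ 2) (w : V3) :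
    (jap v ^ γ * Real.sqrt (2 * (1 + R ^ 2)) ^ γ * δ ^ 2 * ‖ξ‖ ^ 2) *
      (1 - ‖w‖ ^ 2 / R ^ 2 -
        ({w : V3 | (b.repr w).ofLp ∈ slabBox R δ (b.repr v 1)}.indicator (fun _ => (1:ℝ)) w))
      ≤ quadForm (cutoffKernel γ (v - w)) ξ := by
  have hj := jap_pos v
  have hj' := jap_pos (v - w)
  have hs : 0 < Real.sqrt (2 * (1 + R ^ 2)) := Real.sqrt_pos.2 (by positivity)
  have hK : 0 ≤ jap v ^ γ * Real.sqrt (2 * (1 + R ^ 2)) ^ γ * δ ^ 2 * ‖ξ‖ ^ 2 := by positivity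
  rw [quad_cutoff]
  have hq : 0 ≤ jap (v - w) ^ γ * (‖v - w‖ ^ 2 * ‖ξ‖ ^ 2 - ⟪v - w, ξ⟫ ^ 2) :=
    mul_nonneg (by positivity) (cs _ _)
  have hd : 0 ≤ ‖w‖ ^ 2 / R ^ 2 := by positivity
  by_cases hA : (b.repr w).ofLp ∈ slabBox R δ (b.repr v 1)
  · rw [Set.indicator_of_mem (by exact hA)]
    exact le_trans (mul_nonpos_of_nonneg_of_nonpos hK (by linarith)) hq
  rw [Set.indicator_of_notMem (by exact hA)]
  by_cases hw : ‖w‖ ≤ R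
  · have hk : ∀ k, |b.repr w k| ≤ R := fun k =>
      (PiLp.norm_apply_le (b.repr w) k).trans (by rwa [LinearIsometryEquiv.norm_map])
    have hδ' : δ ^ 2 ≤ (b.repr (v - w) 1) ^ 2 := by
      by_contra hcon
      push Not at hcon
      have h1 := abs_lt_of_sq_lt_sq hcon hδ.le
      rw [map_sub, PiLp.sub_apply, abs_lt] at h1
      apply hA
      have a0 := abs_le.1 (hk 0)
      have a2 := abs_le.1 (hk 2)
      constructor
      · intro i; fin_cases i <;> simp <;> linarith
      · intro i; fin_cases i <;> simp <;> linarith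
    have h1 : jap v ^ γ * Real.sqrt (2 * (1 + R ^ 2)) ^ γ ≤ jap (v - w) ^ γ := by
      rw [← Real.mul_rpow hj.le hs.le]
      exact Real.rpow_le_rpow_of_nonpos hj' (peetre v w R hw) hγ.le
    have h2 : δ ^ 2 * ‖ξ‖ ^ 2 ≤ ‖v - w‖ ^ 2 * ‖ξ‖ ^ 2 - ⟪v - w, ξ⟫ ^ 2 :=
      (mul_le_mul_of_nonneg_right hδ' (sq_nonneg _)).trans (hb _)
    have h3 := mul_le_mul h1 h2 (by positivity) (by positivity)
    calc _ ≤ (jap v ^ γ * Real.sqrt (2 * (1 + R ^ 2)) ^ γ * δ ^ 2 * ‖ξ‖ ^ 2) * 1 :=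
          mul_le_mul_of_nonneg_left (by linarith) hK
      _ = jap v ^ γ * Real.sqrt (2 * (1 + R ^ 2)) ^ γ * (δ ^ 2 * ‖ξ‖ ^ 2) := by ring
      _ ≤ _ := h3
  · push Not at hw
    refine le_trans (mul_nonpos_of_nonneg_of_nonpos hK ?_) hq
    have : 1 ≤ ‖w‖ ^ 2 / R ^ 2 := by
      rw [one_le_div (by positivity)]
      exact pow_le_pow_left₀ hR.le hw.le 2
    linarith

lemma ellip_part (γ : ℝ) (hγ : γ < 0) (E Hb : ℝ) (hEp : 0 < E) (hHb : 0 < Hb) :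
      ∃ c₀ : ℝ, 0 < c₀ ∧
        ∀ f : V3 → ℝ, (∀ v, 0 ≤ f v) → Integrable f → (∫ v, f v) = 1 →
          Integrable (fun v => ‖v‖ ^ 2 * f v) → (∫ v, ‖v‖ ^ 2 * f v) ≤ E →
          Integrable (fun v => f v * Real.log (f v)) → entropy f ≤ Hb →
          ∀ v ξ : V3, c₀ * jap v ^ γ * ‖ξ‖ ^ 2 ≤ quadForm (cutoffConv γ f v) ξ := by
  obtain ⟨G, hG⟩ : ∃ G : ℝ, G = ∫ v : V3, Real.exp (-‖v‖ ^ 2) := ⟨_, rfl⟩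
  have hG0 : 0 ≤ G := hG ▸ integral_nonneg fun v => (Real.exp_pos _).le
  obtain ⟨R, hR, hR2⟩ : ∃ R : ℝ, 0 < R ∧ R ^ 2 = 4 * E :=
    ⟨Real.sqrt (4 * E), Real.sqrt_pos.2 (by linarith), Real.sq_sqrt (by linarith)⟩
  obtain ⟨l, hl⟩ : ∃ l : ℝ, l = 8 * (Hb + E + G) := ⟨_, rfl⟩
  have hl0 : 0 < l := by rw [hl]; linarith
  obtain ⟨δ, hδ, hδ2⟩ : ∃ δ : ℝ, 0 < δ ∧ Real.exp l * (8 * δ * R ^ 2) = l / 8 := by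
    refine ⟨l / (8 * (Real.exp l * 8 * R ^ 2)), by positivity, ?_⟩
    have := Real.exp_pos l
    field_simp
  have hs : 0 < Real.sqrt (2 * (1 + R ^ 2)) := Real.sqrt_pos.2 (by positivity)
  refine ⟨Real.sqrt (2 * (1 + R ^ 2)) ^ γ * δ ^ 2 / 2, by positivity, ?_⟩
  intro f h0 hf h1 hE hEle hL hH v ξ
  obtain ⟨hqi, hq⟩ := quad_conv γ hγ f h0 hf hE v ξ
  by_cases hξ : ξ = 0
  · subst hξ; simp [quadForm, bilin]
  obtain ⟨b, hb⟩ := geom ξ hξ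
  obtain ⟨hAm, hAv⟩ := slab_vol b R δ (b.repr v 1) hR.le hδ.le
  have hpt := pointwise γ hγ R δ hR hδ v ξ b hb
  set A := {w : V3 | (b.repr w).ofLp ∈ slabBox R δ (b.repr v 1)} with hAdef
  have hmass := mass_bound f h0 hf hE hL A hAm (by rw [hAv]; exact ENNReal.ofReal_ne_top) l
  have hreal : volume.real A = 8 * δ * R ^ 2 := by
    rw [Measure.real, hAv, ENNReal.toReal_ofReal (by positivity)]
  rw [hreal, hδ2, ← hG] at hmass
  have hA4 : ∫ w in A, f w ≤ 1 / 4 := by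
    by_contra hcon
    push Not at hcon
    have := mul_lt_mul_of_pos_left hcon hl0
    linarith
  have hj := jap_pos v
  set K := jap v ^ γ * Real.sqrt (2 * (1 + R ^ 2)) ^ γ * δ ^ 2 * ‖ξ‖ ^ 2 with hK
  have hK0 : 0 ≤ K := by positivity
  have hint : Integrable (fun w => K * (f w - (‖w‖ ^ 2 * f w) / R ^ 2 - A.indicator f w)) :=
    ((hf.sub (hE.div_const _)).sub (hf.indicator hAm)).const_mul K
  have hle : ∫ w, K * (f w - (‖w‖ ^ 2 * f w) / R ^ 2 - A.indicator f w)
      ≤ ∫ w, quadForm (cutoffKernel γ (v - w)) ξ * f w := by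
    refine integral_mono hint hqi fun w => ?_
    have h := mul_le_mul_of_nonneg_right (hpt w) (h0 w)
    refine le_trans (le_of_eq ?_) h
    by_cases hw : w ∈ A
    · simp only [hw, Set.indicator_of_mem]; ring
    · simp only [hw, not_false_eq_true, Set.indicator_of_notMem]; ring
  rw [hq]
  refine le_trans ?_ hle
  have i1 : Integrable (fun w => f w - (‖w‖ ^ 2 * f w) / R ^ 2) := hf.sub (hE.div_const _)
  rw [integral_const_mul, integral_sub i1 (hf.indicator hAm),
    integral_sub hf (hE.div_const _), integral_div, h1, integral_indicator hAm]
  have hE4 : (∫ w, ‖w‖ ^ 2 * f w) / R ^ 2 ≤ 1 / 4 := by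
    rw [hR2, div_le_iff₀ (by positivity)]; linarith
  calc _ = K * (1 / 2) := by rw [hK]; ring
    _ ≤ _ := mul_le_mul_of_nonneg_left (by linarith) hK0

/-- the cut-off kernel ã(z) = ⟨z⟩^γ|z|²Π(z) is smooth, dominated by a,
and its convolution with a density of bounded energy and entropy is uniformly
elliptic with weight ⟨v⟩^γ (Lemma 3 of the paper). -/
theorem cutoff_kernel_ellipticity (γ : ℝ) (hγ : γ ∈ Set.Ico (-3 : ℝ) 0) :
    (∀ i j : Fin 3, ContDiff ℝ (⊤ : ℕ∞) (fun z : V3 => cutoffKernel γ z i j)) ∧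
    (∀ z ξ : V3, quadForm (cutoffKernel γ z) ξ ≤ quadForm (landauKernel γ z) ξ) ∧
    (∀ E Hb : ℝ, 0 < E → 0 < Hb →
      ∃ c₀ : ℝ, 0 < c₀ ∧
        ∀ f : V3 → ℝ, (∀ v, 0 ≤ f v) → Integrable f → (∫ v, f v) = 1 →
          Integrable (fun v => ‖v‖ ^ 2 * f v) → (∫ v, ‖v‖ ^ 2 * f v) ≤ E →
          Integrable (fun v => f v * Real.log (f v)) → entropy f ≤ Hb →
          ∀ v ξ : V3, c₀ * jap v ^ γ * ‖ξ‖ ^ 2 ≤ quadForm (cutoffConv γ f v) ξ) := by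
  exact ⟨smooth_part γ, dom_part γ hγ, fun E Hb hE hHb => ellip_part γ hγ.2 E Hb hE hHb⟩

end
end

section
/- Let γ ∈ [-3,-2] and let f be a bounded probability density on ℝ³. Define c̄(v) = 2(γ+3) ∫ |v−w|^γ f(w) dw if γ ∈ (−3,−2], and c̄(v) = 8π f(v) if γ = −3. Then c̄ is non-negative and there exists a constant C depending only on γ such that c̄(v) ≤ C (‖f‖_{L^∞(ℝ³)} + 1) for all v ∈ ℝ³. -/
noncomputable section

open MeasureTheory Real
open scoped ENNReal RealInnerProductSpace

/-- the zero order coefficient c̄ is non-negative and bounded by a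
constant depending on ‖f‖_∞ (Lemma 9 of the paper). -/
theorem cbar_nonneg_bounded (γ : ℝ) (hγ : γ ∈ Set.Icc (-3 : ℝ) (-2)) :
    ∃ C : ℝ, 0 < C ∧
      ∀ f : V3 → ℝ, (∀ v, 0 ≤ f v) → Integrable f → (∫ v, f v) = 1 →
        ∀ B : ℝ, (∀ v, f v ≤ B) →
          ∀ v : V3, 0 ≤ cbar γ f v ∧ cbar γ f v ≤ C * (B + 1) := by
  obtain ⟨h1, h2⟩ := hγ
  by_cases h3 : γ = -3
  · refine ⟨8 * Real.pi, by positivity, ?_⟩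
    intro f hf _ _ B hB v
    have hp := Real.pi_pos
    simp only [cbar, if_pos h3]
    refine ⟨mul_nonneg (by positivity) (hf v), ?_⟩
    apply mul_le_mul_of_nonneg_left _ (by positivity)
    linarith [hB v]
  have h4 : 0 < γ + 3 := by
    rcases lt_or_eq_of_le h1 with h | h
    · linarith
    · exact absurd h.symm h3
  set k : V3 → ℝ := (Metric.ball (0 : V3) 1).indicator (fun z => ‖z‖ ^ γ) with hk
  have hk0 : ∀ z, 0 ≤ k z := fun z =>
    Set.indicator_nonneg (fun z _ => Real.rpow_nonneg (norm_nonneg z) γ) z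
  have hkint : Integrable k := by
    rw [hk, integrable_indicator_iff Metric.isOpen_ball.measurableSet]
    refine integrableOn_ball_of_norm_le_rpow (C := 1) (α := -γ) ?_ ?_ ?_ ?_
    · simp
    · simp; linarith
    · filter_upwards with x
      rw [Real.norm_of_nonneg (Real.rpow_nonneg (norm_nonneg x) γ)]
      simp
    · have : Measurable (fun z : V3 => ‖z‖ ^ γ) := by fun_prop
      exact this.aestronglyMeasurable
  have hI : 0 ≤ ∫ z, k z := integral_nonneg hk0
  refine ⟨2 * (γ + 3) * ((∫ z, k z) + 1), by positivity, ?_⟩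
  intro f hf hfi hf1 B hB v
  have hB0 : 0 ≤ B := (hf v).trans (hB v)
  have hnn : ∀ w, 0 ≤ ‖v - w‖ ^ γ * f w := fun w =>
    mul_nonneg (Real.rpow_nonneg (norm_nonneg _) γ) (hf w)
  have hki : Integrable (fun w => k (v - w)) := hkint.comp_sub_left v
  have hle : (∫ w, ‖v - w‖ ^ γ * f w) ≤ B * (∫ z, k z) + 1 := by
    calc (∫ w, ‖v - w‖ ^ γ * f w) ≤ ∫ w, (B * k (v - w) + f w) := by
          refine integral_mono_of_nonneg (Filter.Eventually.of_forall hnn)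
            ((hki.const_mul B).add hfi) (Filter.Eventually.of_forall fun w => ?_)
          change ‖v - w‖ ^ γ * f w ≤ B * k (v - w) + f w
          by_cases hw : v - w ∈ Metric.ball (0 : V3) 1
          · have : k (v - w) = ‖v - w‖ ^ γ := Set.indicator_of_mem hw _
            rw [this, mul_comm B]
            have := mul_le_mul_of_nonneg_left (hB w)
              (Real.rpow_nonneg (norm_nonneg (v - w)) γ)
            linarith [hf w]
          · have : k (v - w) = 0 := Set.indicator_of_notMem hw _
            rw [this]
            have h1' : 1 ≤ ‖v - w‖ := by simpa using hw
            have := Real.rpow_le_one_of_one_le_of_nonpos h1' (by linarith : γ ≤ 0)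
            nlinarith [hf w]
      _ = B * (∫ z, k z) + 1 := by
          rw [integral_add (hki.const_mul B) hfi, integral_const_mul, hf1,
            integral_sub_left_eq_self k volume v]
  simp only [cbar, if_neg h3]
  refine ⟨mul_nonneg (by positivity) (integral_nonneg hnn), ?_⟩
  rw [mul_assoc (2 * (γ + 3))]
  apply mul_le_mul_of_nonneg_left _ (by positivity)
  nlinarith

end
end

section
/- (Hölder continuity of ā) Let γ ∈ [-3,-2], set α = (γ+5)/4, and let f be a bounded probability density on ℝ³. Then the matrix-valued function ā(v) := ∫ a(v−w) f(w) dw is α-Hölder continuous on ℝ³, and there exists C > 0 depending only on α (equivalently, on γ) such that for all v, v' ∈ ℝ³: ‖ā(v) − ā(v')‖ ≤ C (1 + ‖f‖_{L^∞(ℝ³)}) |v − v'|^α. -/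
noncomputable section

open MeasureTheory Real
open scoped ENNReal RealInnerProductSpace

theorem aux_unit_le (x : V3) (i : Fin 3) : |x i / ‖x‖| ≤ 1 := by
  rw [abs_div, abs_norm]
  apply div_le_one_of_le₀ _ (norm_nonneg _)
  have := PiLp.norm_apply_le x i
  simpa using this

theorem aux_proj_le (x : V3) (i j : Fin 3) : |proj x i j| ≤ 2 := by
  unfold proj
  have h1 := aux_unit_le x i
  have h2 := aux_unit_le x j
  have h3 : |x i / ‖x‖ * (x j / ‖x‖)| ≤ 1 := by
    rw [abs_mul]; exact mul_le_one₀ h1 (abs_nonneg _) h2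
  rw [abs_le] at h3 ⊢
  split_ifs <;> constructor <;> linarith [h3.1, h3.2]

theorem aux_unit_diff (x y : V3) (hx : 0 < ‖x‖) (hxy : ‖x‖ ≤ ‖y‖) (i : Fin 3) :
    |x i / ‖x‖ - y i / ‖y‖| ≤ 2 * (‖x - y‖ / ‖y‖) := by
  have hy : 0 < ‖y‖ := hx.trans_le hxy
  have e : x i / ‖x‖ - y i / ‖y‖ =
      (x i / ‖x‖) * ((‖y‖ - ‖x‖) / ‖y‖) + (x i - y i) / ‖y‖ := by
    field_simp; ring
  have h1 := aux_unit_le x i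
  have h2 : |x i - y i| ≤ ‖x - y‖ := by simpa using PiLp.norm_apply_le (x - y) i
  have h3 : ‖y‖ - ‖x‖ ≤ ‖x - y‖ := by
    rw [norm_sub_rev]; exact norm_sub_norm_le y x
  rw [e]
  refine (abs_add_le _ _).trans ?_
  rw [abs_mul, abs_of_nonneg (div_nonneg (sub_nonneg.2 hxy) hy.le), abs_div _ ‖y‖, abs_norm]
  have a1 : |x i / ‖x‖| * ((‖y‖ - ‖x‖) / ‖y‖) ≤ 1 * (‖x - y‖ / ‖y‖) := by
    apply mul_le_mul h1 _ _ zero_le_one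
    · gcongr
    · exact div_nonneg (sub_nonneg.2 hxy) hy.le
  have a2 : |x i - y i| / ‖y‖ ≤ ‖x - y‖ / ‖y‖ := by gcongr
  linarith

theorem aux_proj_diff (x y : V3) (hx : 0 < ‖x‖) (hxy : ‖x‖ ≤ ‖y‖) (i j : Fin 3) :
    |proj x i j - proj y i j| ≤ 4 * (‖x - y‖ / ‖y‖) := by
  have e : proj x i j - proj y i j =
      -((x i / ‖x‖ - y i / ‖y‖) * (x j / ‖x‖) + (y i / ‖y‖) * (x j / ‖x‖ - y j / ‖y‖)) := by
    unfold proj; ring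
  rw [e, abs_neg]
  refine (abs_add_le _ _).trans ?_
  rw [abs_mul, abs_mul]
  have h1 := aux_unit_diff x y hx hxy i
  have h2 := aux_unit_diff x y hx hxy j
  have h3 := aux_unit_le x j
  have h4 := aux_unit_le y i
  have a := mul_le_of_le_one_right (abs_nonneg (x i / ‖x‖ - y i / ‖y‖)) h3
  have b := mul_le_of_le_one_left (abs_nonneg (x j / ‖x‖ - y j / ‖y‖)) h4
  linarith

theorem aux_rpow_diff (s m M : ℝ) (hs : -1 ≤ s) (hs0 : s ≤ 0) (hm : 0 < m) (hM : m ≤ M) :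
    |m ^ s - M ^ s| ≤ m ^ s * ((M - m) / M) := by
  have hM0 : 0 < M := hm.trans_le hM
  have h1 : M ^ s ≤ m ^ s := Real.rpow_le_rpow_of_nonpos hm hM hs0
  rw [abs_of_nonneg (by linarith)]
  have h2 : M ^ s = m ^ s * (m / M) ^ (-s) := by
    rw [Real.div_rpow hm.le hM0.le, Real.rpow_neg hm.le, Real.rpow_neg hM0.le]
    have := (Real.rpow_pos_of_pos hm s).ne'
    have := (Real.rpow_pos_of_pos hM0 s).ne'
    field_simp
  have h3 : m / M ≤ (m / M) ^ (-s) := by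
    have := Real.rpow_le_rpow_of_exponent_ge (div_pos hm hM0) ((div_le_one hM0).2 hM)
      (show -s ≤ 1 by linarith)
    simpa using this
  have h4 : (M - m) / M = 1 - m / M := by field_simp
  have h5 := mul_le_mul_of_nonneg_left h3 (Real.rpow_pos_of_pos hm s).le
  rw [h4, h2]; linarith

theorem aux_kernel_diff (γ : ℝ) (hγ : γ ∈ Set.Icc (-3 : ℝ) (-2)) (x y : V3) (hx : 0 < ‖x‖)
    (hxy : ‖x‖ ≤ ‖y‖) (i j : Fin 3) :
    |landauKernel γ x i j - landauKernel γ y i j| ≤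
      12 * ‖x - y‖ ^ ((γ + 5) / 4) * ‖x‖ ^ (γ + 2 - (γ + 5) / 4) := by
  obtain ⟨g1, g2⟩ := hγ
  have hy : 0 < ‖y‖ := hx.trans_le hxy
  set d := ‖x - y‖ with hd
  have hd0 : 0 ≤ d := norm_nonneg _
  set α := (γ + 5) / 4 with hα
  have e : landauKernel γ x i j - landauKernel γ y i j =
      (‖x‖ ^ (γ + 2) - ‖y‖ ^ (γ + 2)) * proj y i j +
        ‖x‖ ^ (γ + 2) * (proj x i j - proj y i j) := by
    unfold landauKernel; ring
  have hp : 0 < ‖x‖ ^ (γ + 2) := Real.rpow_pos_of_pos hx _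
  have h3 : ‖y‖ - ‖x‖ ≤ d := by
    rw [hd, norm_sub_rev]; exact norm_sub_norm_le y x
  have h1 : |‖x‖ ^ (γ + 2) - ‖y‖ ^ (γ + 2)| ≤ ‖x‖ ^ (γ + 2) * (d / ‖y‖) := by
    refine (aux_rpow_diff (γ + 2) _ _ (by linarith) (by linarith) hx hxy).trans ?_
    gcongr
  have hdy : 0 ≤ d / ‖y‖ := by positivity
  have hk : |landauKernel γ x i j - landauKernel γ y i j| ≤ 6 * (‖x‖ ^ (γ + 2) * (d / ‖y‖)) := by
    rw [e]
    refine (abs_add_le _ _).trans ?_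
    rw [abs_mul, abs_mul, abs_of_pos hp]
    have a := mul_le_mul h1 (aux_proj_le y i j) (abs_nonneg _) (by positivity)
    have b := mul_le_mul_of_nonneg_left (aux_proj_diff x y hx hxy i j) hp.le
    rw [← hd] at b
    linarith
  have hd2 : d ≤ 2 * ‖y‖ := by
    have := norm_sub_le x y
    linarith
  have hr : d / ‖y‖ ≤ 2 * (d ^ α * ‖x‖ ^ (-α)) := by
    have q0 : 0 ≤ d / ‖y‖ / 2 := by positivity
    have q1 : d / ‖y‖ / 2 ≤ 1 := by
      rw [div_div, div_le_one (by positivity)]; linarith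
    have q2 : d / ‖y‖ / 2 ≤ (d / ‖y‖ / 2) ^ α :=
      Real.self_le_rpow_of_le_one q0 q1 (by rw [hα]; linarith)
    have q3 : (d / ‖y‖ / 2) ^ α ≤ (d / ‖x‖) ^ α := by
      apply Real.rpow_le_rpow q0 _ (by rw [hα]; linarith)
      calc d / ‖y‖ / 2 ≤ d / ‖y‖ := by linarith
        _ ≤ d / ‖x‖ := by gcongr
    rw [Real.div_rpow hd0 hx.le] at q3
    rw [Real.rpow_neg hx.le, ← div_eq_mul_inv]
    linarith
  have hs : ‖x‖ ^ (γ + 2 - α) = ‖x‖ ^ (γ + 2) * ‖x‖ ^ (-α) := by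
    rw [sub_eq_add_neg, Real.rpow_add hx]
  rw [hs]
  have := mul_le_mul_of_nonneg_left hr hp.le
  linarith

theorem aux_kernel_diff' (γ : ℝ) (hγ : γ ∈ Set.Icc (-3 : ℝ) (-2)) (x y : V3) (hx : x ≠ 0)
    (hy : y ≠ 0) (i j : Fin 3) :
    |landauKernel γ x i j - landauKernel γ y i j| ≤
      12 * ‖x - y‖ ^ ((γ + 5) / 4) *
        (‖x‖ ^ (γ + 2 - (γ + 5) / 4) + ‖y‖ ^ (γ + 2 - (γ + 5) / 4)) := by
  have nx : 0 ≤ ‖x‖ ^ (γ + 2 - (γ + 5) / 4) := by positivity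
  have ny : 0 ≤ ‖y‖ ^ (γ + 2 - (γ + 5) / 4) := by positivity
  have nd : 0 ≤ 12 * ‖x - y‖ ^ ((γ + 5) / 4) := by positivity
  rcases le_total ‖x‖ ‖y‖ with h | h
  · refine (aux_kernel_diff γ hγ x y (norm_pos_iff.2 hx) h i j).trans ?_
    apply mul_le_mul_of_nonneg_left _ nd; linarith
  · rw [abs_sub_comm]
    refine (aux_kernel_diff γ hγ y x (norm_pos_iff.2 hy) h i j).trans ?_
    rw [norm_sub_rev y x]
    apply mul_le_mul_of_nonneg_left _ nd; linarith

/-- The singular part of the weight. -/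
def auxSing (p : ℝ) (z : V3) : ℝ := (Set.Iio (1 : ℝ)).indicator (fun r => r ^ p) ‖z‖

theorem auxSing_nonneg (p : ℝ) (z : V3) : 0 ≤ auxSing p z := by
  unfold auxSing
  unfold Set.indicator
  split_ifs
  · exact Real.rpow_nonneg (norm_nonneg z) p
  · exact le_rfl

theorem auxSing_int (p : ℝ) (hp : -2 ≤ p) : Integrable (auxSing p) := by
  unfold auxSing
  rw [MeasureTheory.integrable_fun_norm_addHaar (volume : Measure V3)
    (f := (Set.Iio (1 : ℝ)).indicator (fun r => r ^ p))]
  have h : IntegrableOn (fun y : ℝ => y ^ (2 + p)) (Set.Ioo 0 1) :=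
    (intervalIntegral.integrableOn_Ioo_rpow_iff one_pos).2 (by linarith)
  have h2 : IntegrableOn ((Set.Iio (1 : ℝ)).indicator (fun y : ℝ => y ^ (2 + p)))
      (Set.Ioi 0) := by
    rw [IntegrableOn, integrable_indicator_iff measurableSet_Iio, IntegrableOn,
      Measure.restrict_restrict measurableSet_Iio, Set.inter_comm]
    exact h
  refine h2.congr_fun ?_ measurableSet_Ioi
  intro y hy
  have hy' : (0:ℝ) < y := hy
  by_cases h1 : y < 1
  · simp [Set.indicator, h1, Real.rpow_add hy']
  · simp [Set.indicator, h1]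

theorem aux_rpow_le (p : ℝ) (hp0 : p ≤ 0) (z : V3) : ‖z‖ ^ p ≤ 1 + auxSing p z := by
  unfold auxSing
  by_cases h : ‖z‖ < 1
  · simp [Set.indicator, h]
  · simp only [Set.indicator, Set.mem_Iio, h, if_false, add_zero]
    exact Real.rpow_le_one_of_one_le_of_nonpos (not_lt.1 h) hp0

theorem aux_dom (p : ℝ) (hp : -2 ≤ p) (f : V3 → ℝ) (hi : Integrable f) (B : ℝ) (v : V3) :
    Integrable (fun w => f w + B * auxSing p (v - w)) := by
  have := (auxSing_int p hp).comp_sub_left v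
  exact hi.add (this.const_mul B)

theorem aux_int (p : ℝ) (hp : -2 ≤ p) (hp0 : p ≤ 0) (f : V3 → ℝ) (hf : ∀ v, 0 ≤ f v)
    (hi : Integrable f) (h1 : (∫ v, f v) = 1) (B : ℝ) (hB : ∀ v, f v ≤ B) (v : V3) :
    Integrable (fun w => ‖v - w‖ ^ p * f w) ∧
      (∫ w, ‖v - w‖ ^ p * f w) ≤ 1 + B * ∫ z, auxSing p z := by
  have hdom := aux_dom p hp f hi B v
  have hle : ∀ w, ‖v - w‖ ^ p * f w ≤ f w + B * auxSing p (v - w) := by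
    intro w
    have a := mul_le_mul_of_nonneg_right (aux_rpow_le p hp0 (v - w)) (hf w)
    have b := mul_le_mul_of_nonneg_right (hB w) (auxSing_nonneg p (v - w))
    linarith
  have hI : Integrable (fun w => ‖v - w‖ ^ p * f w) := by
    refine hdom.mono' ?_ (Filter.Eventually.of_forall fun w => ?_)
    · refine AEStronglyMeasurable.mul ?_ hi.aestronglyMeasurable
      exact Measurable.aestronglyMeasurable (by fun_prop)
    · rw [Real.norm_eq_abs, abs_of_nonneg (mul_nonneg (by positivity) (hf w))]
      exact hle w
  refine ⟨hI, (integral_mono hI hdom hle).trans ?_⟩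
  have hs := (auxSing_int p hp).comp_sub_left v
  rw [integral_add hi (hs.const_mul B), integral_const_mul, h1,
    integral_sub_left_eq_self (auxSing p) volume v]

theorem aux_kernel_int (γ : ℝ) (hγ : γ ∈ Set.Icc (-3 : ℝ) (-2)) (f : V3 → ℝ)
    (hf : ∀ v, 0 ≤ f v)
    (hi : Integrable f) (h1 : (∫ v, f v) = 1) (B : ℝ) (hB : ∀ v, f v ≤ B) (v : V3)
    (i j : Fin 3) :
    Integrable (fun w => landauKernel γ (v - w) i j * f w) := by
  obtain ⟨g1, g2⟩ := hγ
  have h := (aux_int (γ + 2) (by linarith) (by linarith) f hf hi h1 B hB v).1.const_mul 2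
  refine h.mono' ?_ (Filter.Eventually.of_forall fun w => ?_)
  · refine AEStronglyMeasurable.mul ?_ hi.aestronglyMeasurable
    apply Measurable.aestronglyMeasurable
    unfold landauKernel proj
    fun_prop
  · have hp : 0 ≤ ‖v - w‖ ^ (γ + 2) := by positivity
    rw [Real.norm_eq_abs, abs_mul, abs_of_nonneg (hf w), landauKernel, abs_mul, abs_of_nonneg hp]
    have := mul_le_mul_of_nonneg_right
      (mul_le_mul_of_nonneg_left (aux_proj_le (v - w) i j) hp) (hf w)
    linarith

theorem aux_entry (γ : ℝ) (hγ : γ ∈ Set.Icc (-3 : ℝ) (-2)) (f : V3 → ℝ)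
    (hf : ∀ v, 0 ≤ f v)
    (hi : Integrable f) (h1 : (∫ v, f v) = 1) (B : ℝ) (hB : ∀ v, f v ≤ B) (v v' : V3)
    (i j : Fin 3) :
    |abar γ f v i j - abar γ f v' i j| ≤
      24 * (1 + ∫ z, auxSing (γ + 2 - (γ + 5) / 4) z) * (1 + B) * ‖v - v'‖ ^ ((γ + 5) / 4) := by
  have hγ' := hγ
  obtain ⟨g1, g2⟩ := hγ'
  set p := γ + 2 - (γ + 5) / 4 with hp
  set K := ∫ z, auxSing p z with hK
  have hK0 : 0 ≤ K := integral_nonneg (auxSing_nonneg p)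
  have hB0 : 0 ≤ B := (hf 0).trans (hB 0)
  obtain ⟨I1, J1⟩ := aux_int p (by rw [hp]; linarith) (by rw [hp]; linarith) f hf hi h1 B hB v
  obtain ⟨I2, J2⟩ := aux_int p (by rw [hp]; linarith) (by rw [hp]; linarith) f hf hi h1 B hB v'
  set D := ‖v - v'‖ ^ ((γ + 5) / 4) with hD
  have hD0 : 0 ≤ D := by positivity
  unfold abar
  rw [← integral_sub (aux_kernel_int γ hγ f hf hi h1 B hB v i j)
    (aux_kernel_int γ hγ f hf hi h1 B hB v' i j)]
  have hb : |∫ w, (landauKernel γ (v - w) i j * f w - landauKernel γ (v' - w) i j * f w)| ≤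
      ∫ w, 12 * D * (‖v - w‖ ^ p * f w + ‖v' - w‖ ^ p * f w) := by
    rw [← Real.norm_eq_abs]
    refine norm_integral_le_of_norm_le ((I1.add I2).const_mul (12 * D)) ?_
    have ne : ∀ u : V3, ∀ᵐ w ∂(volume : Measure V3), w ≠ u := fun u => by
      simp [ae_iff]
    filter_upwards [ne v, ne v'] with w hw hw'
    rw [← sub_mul, norm_mul, Real.norm_eq_abs, Real.norm_eq_abs, abs_of_nonneg (hf w)]
    have := mul_le_mul_of_nonneg_right (aux_kernel_diff' γ hγ (v - w) (v' - w)
      (sub_ne_zero.2 hw.symm) (sub_ne_zero.2 hw'.symm) i j) (hf w)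
    rw [sub_sub_sub_cancel_right, ← hp, ← hD] at this
    linarith
  refine hb.trans ?_
  rw [integral_const_mul, integral_add I1 I2]
  have h2 : (∫ w, ‖v - w‖ ^ p * f w) + (∫ w, ‖v' - w‖ ^ p * f w) ≤ 2 * ((1 + K) * (1 + B)) := by
    nlinarith
  have := mul_le_mul_of_nonneg_left h2 (show 0 ≤ 12 * D by positivity)
  linarith

theorem aux_matNorm (A : Mat3) (K : ℝ) (hK : 0 ≤ K) (h : ∀ i j, |A i j| ≤ K) :
    matNorm A ≤ 3 * K := by
  unfold matNorm
  apply Real.sqrt_le_iff.2 ⟨by positivity, ?_⟩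
  have : ∀ i j, (A i j) ^ 2 ≤ K ^ 2 := fun i j => sq_le_sq' (abs_le.1 (h i j)).1 (abs_le.1 (h i j)).2
  calc ∑ i, ∑ j, (A i j) ^ 2 ≤ ∑ _i : Fin 3, ∑ _j : Fin 3, K ^ 2 :=
        Finset.sum_le_sum fun i _ => Finset.sum_le_sum fun j _ => this i j
    _ = (3 * K) ^ 2 := by simp; ring

/-- Hölder continuity of ā with exponent α = (γ+5)/4
(Lemma 10 of the paper). -/
theorem abar_holder (γ : ℝ) (hγ : γ ∈ Set.Icc (-3 : ℝ) (-2)) :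
    ∃ C : ℝ, 0 < C ∧
      ∀ f : V3 → ℝ, (∀ v, 0 ≤ f v) → Integrable f → (∫ v, f v) = 1 →
        ∀ B : ℝ, (∀ v, f v ≤ B) →
          ∀ v v' : V3,
            matNorm (abar γ f v - abar γ f v') ≤
              C * (1 + B) * ‖v - v'‖ ^ ((γ + 5) / 4) := by
  have hK0 : 0 ≤ ∫ z, auxSing (γ + 2 - (γ + 5) / 4) z := integral_nonneg (auxSing_nonneg _)
  refine ⟨3 * (24 * (1 + ∫ z, auxSing (γ + 2 - (γ + 5) / 4) z)), by positivity, ?_⟩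
  intro f hf hi h1 B hB v v'
  have hB0 : 0 ≤ B := (hf 0).trans (hB 0)
  have := aux_matNorm (abar γ f v - abar γ f v') _ (by positivity)
    (fun i j => aux_entry γ hγ f hf hi h1 B hB v v' i j)
  linarith

end
end

section
/- (Hölder continuity of c̄, non-Coulomb case) Let γ ∈ (-3,-2], set α = (γ+3)/4, and let f be a bounded probability density on ℝ³. Then the function c̄(v) := 2(γ+3) ∫ |v−w|^γ f(w) dw is α-Hölder continuous on ℝ³, and there exists C > 0 depending only on α (equivalently, on γ) such that for all v, v' ∈ ℝ³: |c̄(v) − c̄(v')| ≤ C (1 + ‖f‖_{L^∞(ℝ³)}) |v − v'|^α. -/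
noncomputable section

open MeasureTheory Real
open scoped ENNReal RealInnerProductSpace

lemma aux_pointwise_le {γ α a b : ℝ} (hγ : γ ∈ Set.Ioc (-3 : ℝ) (-2)) (hα0 : 0 < α) (hα1 : α ≤ 1)
    (ha : 0 ≤ a) (hab : a ≤ b) :
    |a ^ γ - b ^ γ| ≤ 3 * (b - a) ^ α * (a ^ (γ - α) + b ^ (γ - α)) := by
  obtain ⟨h1, h2⟩ := hγ
  have hb : 0 ≤ b := ha.trans hab
  rcases ha.eq_or_lt with rfl | ha'
  · rcases hb.eq_or_lt with rfl | hb'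
    · simp only [sub_self, abs_zero]; positivity
    · rw [Real.zero_rpow (by linarith), Real.zero_rpow (by linarith), zero_sub, abs_neg, sub_zero,
        zero_add, mul_assoc, ← Real.rpow_add hb', abs_of_nonneg (by positivity)]
      have : 0 < b ^ γ := by positivity
      rw [add_sub_cancel]; linarith
  · have hb' : 0 < b := ha'.trans_le hab
    have hle : b ^ γ ≤ a ^ γ := Real.rpow_le_rpow_of_nonpos ha' hab (by linarith)
    rw [abs_of_nonneg (by linarith)]
    have ht0 : 0 < a / b := by positivity
    have ht1 : a / b ≤ 1 := by rw [div_le_one hb']; exact hab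
    have hbern := one_add_mul_self_le_rpow_one_add (s := a / b - 1) (by linarith) (p := -γ)
      (by linarith)
    rw [add_sub_cancel] at hbern
    have e1 : b ^ γ = a ^ γ * (a / b) ^ (-γ) := by
      rw [Real.div_rpow ha hb, Real.rpow_neg ha, Real.rpow_neg hb]
      have : a ^ γ ≠ 0 := by positivity
      have : b ^ γ ≠ 0 := by positivity
      field_simp
    have hx : 1 - a / b ≤ (1 - a / b) ^ α := by
      rcases (sub_nonneg.2 ht1).eq_or_lt with h | h
      · rw [← h]; positivity
      · have := Real.rpow_le_rpow_of_exponent_ge h (by linarith) hα1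
        simpa using this
    have h3 : 1 - (a / b) ^ (-γ) ≤ 3 * (1 - a / b) ^ α := by nlinarith
    have e2 : (1 - a / b) ^ α = (b - a) ^ α * b ^ (-α) := by
      rw [Real.rpow_neg hb, ← div_eq_mul_inv, ← Real.div_rpow (by linarith) hb]
      congr 1; field_simp
    have e3 : b ^ (-α) ≤ a ^ (-α) := Real.rpow_le_rpow_of_nonpos ha' hab (by linarith)
    have hba : 0 ≤ (b - a) ^ α := Real.rpow_nonneg (by linarith) _
    have hag : 0 < a ^ γ := by positivity
    calc a ^ γ - b ^ γ = a ^ γ * (1 - (a / b) ^ (-γ)) := by rw [e1]; ring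
      _ ≤ a ^ γ * (3 * ((b - a) ^ α * a ^ (-α))) := by
        gcongr
        refine h3.trans ?_
        rw [e2]; gcongr
      _ = 3 * (b - a) ^ α * a ^ (γ - α) := by
        rw [sub_eq_add_neg γ α, Real.rpow_add ha']; ring
      _ ≤ _ := by
        gcongr
        have : 0 ≤ b ^ (γ - α) := by positivity
        linarith

lemma aux_pointwise {γ α a b d : ℝ} (hγ : γ ∈ Set.Ioc (-3 : ℝ) (-2)) (hα0 : 0 < α) (hα1 : α ≤ 1)
    (ha : 0 ≤ a) (hb : 0 ≤ b) (hd : |a - b| ≤ d) :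
    |a ^ γ - b ^ γ| ≤ 3 * d ^ α * (a ^ (γ - α) + b ^ (γ - α)) := by
  have hp : 0 ≤ a ^ (γ - α) + b ^ (γ - α) := by positivity
  rcases le_total a b with h | h
  · refine (aux_pointwise_le hγ hα0 hα1 ha h).trans ?_
    have : b - a ≤ d := by rw [abs_sub_comm] at hd; exact (le_abs_self _).trans hd
    have h0 : 0 ≤ b - a := by linarith
    gcongr
  · rw [abs_sub_comm, add_comm]
    refine (aux_pointwise_le hγ hα0 hα1 hb h).trans ?_
    have : a - b ≤ d := (le_abs_self _).trans hd
    have h0 : 0 ≤ a - b := by linarith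
    rw [add_comm] at hp
    gcongr

/-- The truncated kernel. -/
def auxKer (β : ℝ) (z : V3) : ℝ := (Metric.ball (0 : V3) 1).indicator (fun z => ‖z‖ ^ β) z

lemma auxKer_nonneg (β : ℝ) (z : V3) : 0 ≤ auxKer β z :=
  Set.indicator_nonneg (fun _ _ => by positivity) _

lemma auxKer_integrable {β : ℝ} (hβ : -3 < β) : Integrable (auxKer β) := by
  unfold auxKer
  rw [integrable_indicator_iff measurableSet_ball]
  refine (integrableOn_fun_norm_addHaar (volume : Measure V3) (f := fun y : ℝ => y ^ β)).2 ?_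
  have h : IntegrableOn (fun y : ℝ => y ^ (2 + β)) (Set.Ioo 0 1) :=
    (intervalIntegral.integrableOn_Ioo_rpow_iff zero_lt_one).2 (by linarith)
  refine h.congr_fun (fun y hy => ?_) measurableSet_Ioo
  simp only [finrank_euclideanSpace, Fintype.card_fin, smul_eq_mul]
  rw [Real.rpow_add hy.1]
  norm_num

lemma aux_bound {β B : ℝ} (hβ0 : β ≤ 0) {f : V3 → ℝ} (hf0 : ∀ v, 0 ≤ f v)
    (hB : ∀ v, f v ≤ B) (v w : V3) :
    ‖v - w‖ ^ β * f w ≤ f w + B * auxKer β (v - w) := by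
  have hB0 : 0 ≤ B := (hf0 0).trans (hB 0)
  by_cases h : v - w ∈ Metric.ball (0 : V3) 1
  · rw [auxKer, Set.indicator_of_mem h]
    have h1 : 0 ≤ ‖v - w‖ ^ β := by positivity
    nlinarith [hf0 w, hB w]
  · rw [auxKer, Set.indicator_of_notMem h]
    have h1 : 1 ≤ ‖v - w‖ := by simpa using h
    have h2 := Real.rpow_le_one_of_one_le_of_nonpos h1 hβ0
    nlinarith [hf0 w]

lemma aux_integrable {β B : ℝ} (hβ : -3 < β) (hβ0 : β ≤ 0) {f : V3 → ℝ} (hf0 : ∀ v, 0 ≤ f v)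
    (hf : Integrable f) (hB : ∀ v, f v ≤ B) (v : V3) :
    Integrable (fun w => ‖v - w‖ ^ β * f w) := by
  have hk : Integrable (fun w => f w + B * auxKer β (v - w)) :=
    hf.add (((auxKer_integrable hβ).comp_sub_left v).const_mul B)
  refine hk.mono' ?_ (Filter.Eventually.of_forall fun w => ?_)
  · refine AEStronglyMeasurable.mul (Measurable.aestronglyMeasurable ?_) hf.1
    fun_prop
  · rw [Real.norm_of_nonneg (mul_nonneg (by positivity) (hf0 w))]
    exact aux_bound hβ0 hf0 hB v w

lemma aux_integral_le {β B : ℝ} (hβ : -3 < β) (hβ0 : β ≤ 0) {f : V3 → ℝ} (hf0 : ∀ v, 0 ≤ f v)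
    (hf : Integrable f) (hf1 : ∫ v, f v = 1) (hB : ∀ v, f v ≤ B) (v : V3) :
    ∫ w, ‖v - w‖ ^ β * f w ≤ 1 + B * ∫ z, auxKer β z := by
  have hk := ((auxKer_integrable hβ).comp_sub_left v).const_mul B
  calc _ ≤ ∫ w, (f w + B * auxKer β (v - w)) :=
        integral_mono (aux_integrable hβ hβ0 hf0 hf hB v) (hf.add hk)
          (aux_bound hβ0 hf0 hB v)
    _ = _ := by
      rw [integral_add hf hk, hf1, integral_const_mul, integral_sub_left_eq_self (auxKer β)]

/-- Hölder continuity of c̄ with exponent α = (γ+3)/4 in the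
non-Coulomb case (Lemma 11 of the paper). -/
theorem cbar_holder (γ : ℝ) (hγ : γ ∈ Set.Ioc (-3 : ℝ) (-2)) :
    ∃ C : ℝ, 0 < C ∧
      ∀ f : V3 → ℝ, (∀ v, 0 ≤ f v) → Integrable f → (∫ v, f v) = 1 →
        ∀ B : ℝ, (∀ v, f v ≤ B) →
          ∀ v v' : V3,
            |cbar γ f v - cbar γ f v'| ≤ C * (1 + B) * ‖v - v'‖ ^ ((γ + 3) / 4) := by
  have hγ' := hγ
  obtain ⟨h1, h2⟩ := hγ'
  set α := (γ + 3) / 4 with hα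
  have hα0 : 0 < α := by linarith
  have hα1 : α ≤ 1 := by linarith
  have hβ : -3 < γ - α := by linarith
  have hβ0 : γ - α ≤ 0 := by linarith
  set K := ∫ z, auxKer (γ - α) z with hK
  have hK0 : 0 ≤ K := integral_nonneg (auxKer_nonneg _)
  have hg : 0 < γ + 3 := by linarith
  refine ⟨2 * (γ + 3) * (3 * (2 * (1 + K))), by positivity, ?_⟩
  intro f hf0 hf hf1 B hB v v'
  have hB0 : 0 ≤ B := (hf0 0).trans (hB 0)
  have i1 := aux_integrable h1 (by linarith) hf0 hf hB v
  have i2 := aux_integrable h1 (by linarith) hf0 hf hB v'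
  have j1 := aux_integrable hβ hβ0 hf0 hf hB v
  have j2 := aux_integrable hβ hβ0 hf0 hf hB v'
  have l1 := aux_integral_le hβ hβ0 hf0 hf hf1 hB v
  have l2 := aux_integral_le hβ hβ0 hf0 hf hf1 hB v'
  have hd : 0 ≤ ‖v - v'‖ ^ α := by positivity
  have key : |(∫ w, ‖v - w‖ ^ γ * f w) - ∫ w, ‖v' - w‖ ^ γ * f w| ≤
      3 * ‖v - v'‖ ^ α * (2 * (1 + B * K)) := by
    rw [← integral_sub i1 i2, ← Real.norm_eq_abs]
    have := norm_integral_le_of_norm_le (f := fun w => ‖v - w‖ ^ γ * f w - ‖v' - w‖ ^ γ * f w)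
      ((j1.add j2).const_mul (3 * ‖v - v'‖ ^ α)) (Filter.Eventually.of_forall fun w => ?_)
    · refine this.trans ?_
      rw [integral_const_mul]
      gcongr
      simp only [Pi.add_apply]
      rw [integral_add j1 j2]
      linarith
    · have hn : |‖v - w‖ - ‖v' - w‖| ≤ ‖v - v'‖ := by
        have := abs_norm_sub_norm_le (v - w) (v' - w)
        rwa [sub_sub_sub_cancel_right] at this
      have hp := aux_pointwise hγ hα0 hα1 (norm_nonneg (v - w)) (norm_nonneg (v' - w)) hn
      rw [← sub_mul, Real.norm_eq_abs, abs_mul, abs_of_nonneg (hf0 w)]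
      simp only [Pi.add_apply]
      rw [← add_mul, ← mul_assoc]
      exact mul_le_mul_of_nonneg_right hp (hf0 w)
  have hne : γ ≠ -3 := by linarith
  simp only [cbar, if_neg hne]
  rw [← mul_sub, abs_mul, abs_of_pos (by positivity : 0 < 2 * (γ + 3))]
  calc _ ≤ 2 * (γ + 3) * (3 * ‖v - v'‖ ^ α * (2 * (1 + B * K))) := by gcongr
    _ ≤ 2 * (γ + 3) * (3 * ‖v - v'‖ ^ α * (2 * ((1 + K) * (1 + B)))) := by
      gcongr
      nlinarith
    _ = _ := by ring

end
end
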